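/- Let X = {1, 3, 5, 7.02, 9.02, 11.02, 17, 18, 19, 20, 22.01, 23.01, 24.01, 25.01} ⊂ ℝ with the metric d(x,y) = |x − y|, let N_p = 3, and let C be the 3-clustering {{1, 3, 5, 7.02, 9.02, 11.02}, {17, 18, 19, 20}, {22.01, 23.01, 24.01, 25.01}}. Then C is weakly separable and LM-separable for N_p = 3, yet for every ε ≥ 0, C does not extend the partial clustering consisting of all ε-clusters of X: there is no bijection f from the set of ε-clusters of X to C such that every ε-cluster is a (nonempty) subset of its image under f. (Hence a weakly separable, LM-separable clustering need not extend any ε-cut of the dendrogram.) -/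

import Mathlib

variable {α : Type*}

/-- Sparsity ε_{N_p}(x): smallest ε ≥ 0 such that at least N_p points of X lie within
distance ε of x. -/
noncomputable def sparsity [MetricSpace α] (X : Finset α) (Np : ℕ) (x : α) : ℝ :=
  sInf {ε : ℝ | 0 ≤ ε ∧ Np ≤ (X.filter (fun y => dist x y ≤ ε)).card}

/-- x is ε-connected to y: there is a finite sequence of points of X from x to y,
each of sparsity at most ε, with consecutive distances at most ε. -/
def EpsConn [MetricSpace α] (X : Finset α) (Np : ℕ) (ε : ℝ) (x y : α) : Prop :=
  x ∈ X ∧ sparsity X Np x ≤ ε ∧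
    Relation.ReflTransGen (fun a b => b ∈ X ∧ sparsity X Np b ≤ ε ∧ dist a b ≤ ε) x y

/-- A set c is ε-connected if every pair of points of c is ε-connected. -/
def SetConn [MetricSpace α] (X : Finset α) (Np : ℕ) (ε : ℝ) (c : Finset α) : Prop :=
  ∀ x ∈ c, ∀ y ∈ c, EpsConn X Np ε x y

/-- ε*(c): the minimum ε such that c is ε-connected. -/
noncomputable def setSparsity [MetricSpace α] (X : Finset α) (Np : ℕ) (c : Finset α) : ℝ :=
  sInf {ε : ℝ | SetConn X Np ε c}

/-- ε(x,y): the minimum ε such that x is ε-connected to y. -/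
noncomputable def epsDist [MetricSpace α] (X : Finset α) (Np : ℕ) (x y : α) : ℝ :=
  sInf {ε : ℝ | EpsConn X Np ε x y}

/-- ε(x,c): min over y ∈ c of ε(x,y). -/
noncomputable def ptClusterDist [MetricSpace α] (X : Finset α) (Np : ℕ) (x : α)
    (c : Finset α) : ℝ :=
  sInf {e : ℝ | ∃ y ∈ c, e = epsDist X Np x y}

/-- ε(c,c'): min over x ∈ c, y ∈ c' of ε(x,y). -/
noncomputable def clusterDist [MetricSpace α] (X : Finset α) (Np : ℕ)
    (c c' : Finset α) : ℝ :=
  sInf {e : ℝ | ∃ x ∈ c, ∃ y ∈ c', e = epsDist X Np x y}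

/-- A clustering of X: a partition of X into nonempty clusters. -/
def IsClustering (X : Finset α) (C : Finset (Finset α)) : Prop :=
  (∀ c ∈ C, c.Nonempty) ∧ (∀ c ∈ C, ∀ c' ∈ C, c ≠ c' → Disjoint c c') ∧
    (∀ c ∈ C, c ⊆ X) ∧ (∀ x ∈ X, ∃ c ∈ C, x ∈ c)

/-- C is weakly separable: for each cluster c, ε*(c) < min over c' ≠ c of ε(c,c'). -/
def WeaklySeparable [MetricSpace α] (X : Finset α) (Np : ℕ) (C : Finset (Finset α)) : Prop :=
  ∀ c ∈ C, ∀ c' ∈ C, c' ≠ c → setSparsity X Np c < clusterDist X Np c c'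

/-- c is an ε-cluster: a (nonempty) maximal ε-connected subset of X. -/
def IsEpsCluster [MetricSpace α] (X : Finset α) (Np : ℕ) (ε : ℝ) (c : Finset α) : Prop :=
  c.Nonempty ∧ SetConn X Np ε c ∧ ∀ x ∈ X, (∃ y ∈ c, EpsConn X Np ε x y) → x ∈ c

/-- c is a maximal cluster: an ε-cluster for some ε ≥ 0. -/
def IsMaximalCluster [MetricSpace α] (X : Finset α) (Np : ℕ) (c : Finset α) : Prop :=
  ∃ ε : ℝ, 0 ≤ ε ∧ IsEpsCluster X Np ε c

/-- x is a local maximum: every y ∈ X with d(x,y) ≤ ε_{N_p}(x) has sparsity ≥ that of x. -/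
def IsLocalMaxPt [MetricSpace α] (X : Finset α) (Np : ℕ) (x : α) : Prop :=
  x ∈ X ∧ ∀ y ∈ X, dist x y ≤ sparsity X Np x → sparsity X Np x ≤ sparsity X Np y

/-- X_c*: the points of c of minimum sparsity within c. -/
noncomputable def minSparsityPts [MetricSpace α] (X : Finset α) (Np : ℕ)
    (c : Finset α) : Finset α :=
  c.filter (fun x => ∀ y ∈ c, sparsity X Np x ≤ sparsity X Np y)

/-- Relative separability A(x,y) = ε(x,y) / ε_{N_p}(x). -/
noncomputable def relSep [MetricSpace α] (X : Finset α) (Np : ℕ) (x y : α) : ℝ :=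
  epsDist X Np x y / sparsity X Np x

/-- A(x,c) = min over y ∈ c of A(x,y). -/
noncomputable def relSepCluster [MetricSpace α] (X : Finset α) (Np : ℕ) (x : α)
    (c : Finset α) : ℝ :=
  sInf {a : ℝ | ∃ y ∈ c, a = relSep X Np x y}

/-- A^ℓ(C): the minimum A such that for every local maximum x, every y in the cluster of x
with sparsity at most that of x satisfies A(x,y) ≤ A. -/
noncomputable def Aell [MetricSpace α] (X : Finset α) (Np : ℕ)
    (C : Finset (Finset α)) : ℝ :=
  sInf {A : ℝ | ∀ x ∈ X, IsLocalMaxPt X Np x → ∀ c ∈ C, x ∈ c →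
    ∀ y ∈ c, sparsity X Np y ≤ sparsity X Np x → relSep X Np x y ≤ A}

/-- C is LM-separable: A^ℓ(C) < min over distinct clusters c, c' and z ∈ X_c* of A(z,c'). -/
def LMSeparable [MetricSpace α] (X : Finset α) (Np : ℕ) (C : Finset (Finset α)) : Prop :=
  ∀ c ∈ C, ∀ c' ∈ C, c ≠ c' → ∀ z ∈ minSparsityPts X Np c,
    Aell X Np C < relSepCluster X Np z c'

/-- min over x ∈ c of ε_{N_p}(x). -/
noncomputable def minSpars [MetricSpace α] (X : Finset α) (Np : ℕ) (c : Finset α) : ℝ :=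
  sInf (sparsity X Np '' (c : Set α))

/-- max over x ∈ c of ε_{N_p}(x). -/
noncomputable def maxSpars [MetricSpace α] (X : Finset α) (Np : ℕ) (c : Finset α) : ℝ :=
  sSup (sparsity X Np '' (c : Set α))

/-- C is strongly separable: there is an A such that each cluster c is
(A · min sparsity of c)-connected and A · min sparsity of c < min over c' ≠ c of ε(c,c'). -/
def StronglySeparable [MetricSpace α] (X : Finset α) (Np : ℕ)
    (C : Finset (Finset α)) : Prop :=
  ∃ A : ℝ, ∀ c ∈ C, SetConn X Np (A * minSpars X Np c) c ∧
    ∀ c' ∈ C, c' ≠ c → A * minSpars X Np c < clusterDist X Np c c'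

/-- c*(x,ε): the set of points of X that are ε-connected to x. -/
def epsClusterAt [MetricSpace α] (X : Finset α) (Np : ℕ) (ε : ℝ) (x : α) : Set α :=
  {y | EpsConn X Np ε x y}

/-- The 14-point example dataset. -/
noncomputable def Xex : Finset ℝ :=
  {1, 3, 5, 7.02, 9.02, 11.02, 17, 18, 19, 20, 22.01, 23.01, 24.01, 25.01}

/-- The 3-clustering of the example dataset. -/
noncomputable def Cex : Finset (Finset ℝ) :=
  {({1, 3, 5, 7.02, 9.02, 11.02} : Finset ℝ), ({17, 18, 19, 20} : Finset ℝ),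
    ({22.01, 23.01, 24.01, 25.01} : Finset ℝ)}

section General

variable [MetricSpace α] {X : Finset α} {Np : ℕ} {ε δ : ℝ} {x y z : α}

theorem sparsity_nonneg : 0 ≤ sparsity X Np x :=
  Real.sInf_nonneg fun _ h => h.1

theorem sparsity_three_eq {p q r : α} (hp : p ∈ X) (hq : q ∈ X) (hr : r ∈ X)
    (hpq : p ≠ q) (hpr : p ≠ r) (hqr : q ≠ r)
    (dp : dist x p ≤ ε) (dq : dist x q ≤ ε) (dr : dist x r ≤ ε)
    (far : ∀ y ∈ X, y = p ∨ y = q ∨ ε ≤ dist x y) : sparsity X 3 x = ε := by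
  classical
  have hmem : ε ∈ {ε : ℝ | 0 ≤ ε ∧ 3 ≤ (X.filter (fun y => dist x y ≤ ε)).card} := by
    refine ⟨dist_nonneg.trans dp, ?_⟩
    have hsub : ({p, q, r} : Finset α) ⊆ X.filter (fun y => dist x y ≤ ε) := by
      intro a ha
      simp only [Finset.mem_insert, Finset.mem_singleton] at ha
      rcases ha with rfl | rfl | rfl <;> simp [*]
    rw [← Finset.card_eq_three.2 ⟨p, q, r, hpq, hpr, hqr, rfl⟩]
    exact Finset.card_le_card hsub
  refine le_antisymm (csInf_le ⟨0, fun _ h => h.1⟩ hmem) (le_csInf ⟨ε, hmem⟩ ?_)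
  rintro η ⟨-, hη⟩
  by_contra! hlt
  have hsub : X.filter (fun y => dist x y ≤ η) ⊆ {p, q} := by
    intro a ha
    rw [Finset.mem_filter] at ha
    rcases far a ha.1 with rfl | rfl | h
    · simp
    · simp
    · exact absurd (h.trans ha.2) hlt.not_ge
  have := (Finset.card_le_card hsub).trans Finset.card_le_two
  omega

theorem EpsConn.nonneg (h : EpsConn X Np ε x y) : 0 ≤ ε :=
  sparsity_nonneg.trans h.2.1

theorem EpsConn.refl (hx : x ∈ X) (sx : sparsity X Np x ≤ ε) : EpsConn X Np ε x x :=
  ⟨hx, sx, .refl⟩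

theorem EpsConn.single (hx : x ∈ X) (hy : y ∈ X) (sx : sparsity X Np x ≤ ε)
    (sy : sparsity X Np y ≤ ε) (h : dist x y ≤ ε) : EpsConn X Np ε x y :=
  ⟨hx, sx, .single ⟨hy, sy, h⟩⟩

theorem EpsConn.trans (h : EpsConn X Np ε x y) (h' : EpsConn X Np ε y z) :
    EpsConn X Np ε x z :=
  ⟨h.1, h.2.1, h.2.2.trans h'.2.2⟩

theorem EpsConn.symm (h : EpsConn X Np ε x y) : EpsConn X Np ε y x := by
  obtain ⟨hx, sx, h⟩ := h
  suffices y ∈ X ∧ sparsity X Np y ≤ ε ∧ EpsConn X Np ε y x from this.2.2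
  induction h with
  | refl => exact ⟨hx, sx, .refl hx sx⟩
  | tail _ hbc ih =>
    obtain ⟨hc, sc, hd⟩ := hbc
    exact ⟨hc, sc, (EpsConn.single hc ih.1 sc ih.2.1 (by rwa [dist_comm])).trans ih.2.2⟩

theorem EpsConn.mem_right (h : EpsConn X Np ε x y) : y ∈ X :=
  h.symm.1

theorem EpsConn.mem_of_closed {S : Set α} (h : EpsConn X Np ε x y) (hx : x ∈ S)
    (hS : ∀ a ∈ S, ∀ b ∈ X, sparsity X Np b ≤ ε → dist a b ≤ ε → b ∈ S) : y ∈ S := by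
  obtain ⟨-, -, h⟩ := h
  induction h with
  | refl => exact hx
  | tail _ hbc ih => exact hS _ ih _ hbc.1 hbc.2.1 hbc.2.2

theorem SetConn.of_hub {c : Finset α} (h : ∀ x ∈ c, EpsConn X Np ε z x) : SetConn X Np ε c :=
  fun x hx y hy => (h x hx).symm.trans (h y hy)

theorem setSparsity_le {c : Finset α} (hc : c.Nonempty) (h : SetConn X Np ε c) :
    setSparsity X Np c ≤ ε := by
  obtain ⟨w, hw⟩ := hc
  exact csInf_le ⟨0, fun _ h => (h w hw w hw).nonneg⟩ h

theorem epsDist_le (h : EpsConn X Np ε x y) : epsDist X Np x y ≤ ε :=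
  csInf_le ⟨0, fun _ h => h.nonneg⟩ h

theorem le_epsDist {c : Finset α} (hxy : ∃ ε, EpsConn X Np ε x y) (hx : x ∈ c) (hy : y ∉ c)
    (gap : ∀ a ∈ c, ∀ b ∈ X, b ∈ c ∨ δ ≤ dist a b) : δ ≤ epsDist X Np x y := by
  refine le_csInf hxy fun η hη => ?_
  by_contra! hlt
  exact hy <| hη.mem_of_closed (S := c) hx fun a ha b hb _ hab =>
    (gap a ha b hb).resolve_right (hab.trans_lt hlt).not_ge

theorem exists_isEpsCluster (hx : x ∈ X) (sx : sparsity X Np x ≤ ε) :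
    ∃ c, IsEpsCluster X Np ε c ∧ ∀ y, y ∈ c ↔ EpsConn X Np ε x y := by
  classical
  have hmem : ∀ y, y ∈ X.filter (EpsConn X Np ε x) ↔ EpsConn X Np ε x y := fun y => by
    rw [Finset.mem_filter, and_iff_right_iff_imp]
    exact EpsConn.mem_right
  refine ⟨_, ⟨⟨x, (hmem x).2 (.refl hx sx)⟩, SetConn.of_hub fun y hy => (hmem y).1 hy, ?_⟩, hmem⟩
  rintro y - ⟨z, hz, hyz⟩
  exact (hmem y).2 (((hmem z).1 hz).trans hyz.symm)

end General

theorem forall_mem_Xex {P : ℝ → Prop} : (∀ x ∈ Xex, P x) ↔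
    P 1 ∧ P 3 ∧ P 5 ∧ P 7.02 ∧ P 9.02 ∧ P 11.02 ∧ P 17 ∧ P 18 ∧ P 19 ∧ P 20 ∧
      P 22.01 ∧ P 23.01 ∧ P 24.01 ∧ P 25.01 := by
  simp only [Xex, Finset.forall_mem_insert, Finset.mem_singleton, forall_eq]

theorem sparsity_1 : sparsity Xex 3 1 = 4 := by
  refine sparsity_three_eq (p := 1) (q := 3) (r := 5) ?_ ?_ ?_ ?_ ?_ ?_ ?_ ?_ ?_
    (forall_mem_Xex.2 ?_) <;> norm_num [Xex, Real.dist_eq, abs_le, le_abs]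

theorem sparsity_3 : sparsity Xex 3 3 = 2 := by
  refine sparsity_three_eq (p := 3) (q := 1) (r := 5) ?_ ?_ ?_ ?_ ?_ ?_ ?_ ?_ ?_
    (forall_mem_Xex.2 ?_) <;> norm_num [Xex, Real.dist_eq, abs_le, le_abs]

theorem sparsity_5 : sparsity Xex 3 5 = 2.02 := by
  refine sparsity_three_eq (p := 5) (q := 3) (r := 7.02) ?_ ?_ ?_ ?_ ?_ ?_ ?_ ?_ ?_
    (forall_mem_Xex.2 ?_) <;> norm_num [Xex, Real.dist_eq, abs_le, le_abs]

theorem sparsity_7_02 : sparsity Xex 3 7.02 = 2.02 := by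
  refine sparsity_three_eq (p := 7.02) (q := 9.02) (r := 5) ?_ ?_ ?_ ?_ ?_ ?_ ?_ ?_ ?_
    (forall_mem_Xex.2 ?_) <;> norm_num [Xex, Real.dist_eq, abs_le, le_abs]

theorem sparsity_9_02 : sparsity Xex 3 9.02 = 2 := by
  refine sparsity_three_eq (p := 9.02) (q := 7.02) (r := 11.02) ?_ ?_ ?_ ?_ ?_ ?_ ?_ ?_ ?_
    (forall_mem_Xex.2 ?_) <;> norm_num [Xex, Real.dist_eq, abs_le, le_abs]

theorem sparsity_11_02 : sparsity Xex 3 11.02 = 4 := by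
  refine sparsity_three_eq (p := 11.02) (q := 9.02) (r := 7.02) ?_ ?_ ?_ ?_ ?_ ?_ ?_ ?_ ?_
    (forall_mem_Xex.2 ?_) <;> norm_num [Xex, Real.dist_eq, abs_le, le_abs]

theorem sparsity_17 : sparsity Xex 3 17 = 2 := by
  refine sparsity_three_eq (p := 17) (q := 18) (r := 19) ?_ ?_ ?_ ?_ ?_ ?_ ?_ ?_ ?_
    (forall_mem_Xex.2 ?_) <;> norm_num [Xex, Real.dist_eq, abs_le, le_abs]

theorem sparsity_18 : sparsity Xex 3 18 = 1 := by
  refine sparsity_three_eq (p := 18) (q := 17) (r := 19) ?_ ?_ ?_ ?_ ?_ ?_ ?_ ?_ ?_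
    (forall_mem_Xex.2 ?_) <;> norm_num [Xex, Real.dist_eq, abs_le, le_abs]

theorem sparsity_19 : sparsity Xex 3 19 = 1 := by
  refine sparsity_three_eq (p := 19) (q := 18) (r := 20) ?_ ?_ ?_ ?_ ?_ ?_ ?_ ?_ ?_
    (forall_mem_Xex.2 ?_) <;> norm_num [Xex, Real.dist_eq, abs_le, le_abs]

theorem sparsity_20 : sparsity Xex 3 20 = 2 := by
  refine sparsity_three_eq (p := 20) (q := 19) (r := 18) ?_ ?_ ?_ ?_ ?_ ?_ ?_ ?_ ?_
    (forall_mem_Xex.2 ?_) <;> norm_num [Xex, Real.dist_eq, abs_le, le_abs]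

theorem sparsity_22_01 : sparsity Xex 3 22.01 = 2 := by
  refine sparsity_three_eq (p := 22.01) (q := 23.01) (r := 24.01) ?_ ?_ ?_ ?_ ?_ ?_ ?_ ?_ ?_
    (forall_mem_Xex.2 ?_) <;> norm_num [Xex, Real.dist_eq, abs_le, le_abs]

theorem sparsity_23_01 : sparsity Xex 3 23.01 = 1 := by
  refine sparsity_three_eq (p := 23.01) (q := 22.01) (r := 24.01) ?_ ?_ ?_ ?_ ?_ ?_ ?_ ?_ ?_
    (forall_mem_Xex.2 ?_) <;> norm_num [Xex, Real.dist_eq, abs_le, le_abs]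

theorem sparsity_24_01 : sparsity Xex 3 24.01 = 1 := by
  refine sparsity_three_eq (p := 24.01) (q := 23.01) (r := 25.01) ?_ ?_ ?_ ?_ ?_ ?_ ?_ ?_ ?_
    (forall_mem_Xex.2 ?_) <;> norm_num [Xex, Real.dist_eq, abs_le, le_abs]

theorem sparsity_25_01 : sparsity Xex 3 25.01 = 2 := by
  refine sparsity_three_eq (p := 25.01) (q := 24.01) (r := 23.01) ?_ ?_ ?_ ?_ ?_ ?_ ?_ ?_ ?_
    (forall_mem_Xex.2 ?_) <;> norm_num [Xex, Real.dist_eq, abs_le, le_abs]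

theorem one_le_sparsity_Xex : ∀ x ∈ Xex, 1 ≤ sparsity Xex 3 x := by
  rw [forall_mem_Xex, sparsity_1, sparsity_3, sparsity_5, sparsity_7_02, sparsity_9_02,
    sparsity_11_02, sparsity_17, sparsity_18, sparsity_19, sparsity_20, sparsity_22_01,
    sparsity_23_01, sparsity_24_01, sparsity_25_01]
  norm_num

theorem exists_epsConn_Xex {x y : ℝ} (hx : x ∈ Xex) (hy : y ∈ Xex) :
    ∃ ε, EpsConn Xex 3 ε x y :=
  ⟨_, .single hx hy ((le_max_left _ _).trans (le_max_left _ (dist x y)))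
    ((le_max_right _ _).trans (le_max_left _ _)) (le_max_right _ _)⟩

theorem forall_mem_Cex {P : Finset ℝ → Prop} : (∀ c ∈ Cex, P c) ↔
    P {1, 3, 5, 7.02, 9.02, 11.02} ∧ P {17, 18, 19, 20} ∧
      P {22.01, 23.01, 24.01, 25.01} := by
  simp only [Cex, Finset.forall_mem_insert, Finset.mem_singleton, forall_eq]

theorem subset_Xex_of_mem_Cex : ∀ c ∈ Cex, c ⊆ Xex := by
  refine forall_mem_Cex.2 ⟨?_, ?_, ?_⟩ <;> intro x hx <;>
    simp only [Xex, Finset.mem_insert, Finset.mem_singleton] at hx ⊢ <;> tauto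

theorem disjoint_of_mem_Cex : ∀ c ∈ Cex, ∀ c' ∈ Cex, c ≠ c' → Disjoint c c' := by
  simp only [forall_mem_Cex]
  norm_num

/-- A cluster whose sparsest requirement `e` is below its gap `δ` to the rest of `Xex`, whose
minimum sparsity is at most `m < δ / 2`, whose local maxima have sparsity `m`, and whose points of
sparsity at most `m` are `(1.01 * m)`-connected. -/
def IsSeparated (e δ m : ℝ) (c : Finset ℝ) : Prop :=
  SetConn Xex 3 e c ∧ e < δ ∧ (∀ a ∈ c, ∀ b ∈ Xex, b ∈ c ∨ δ ≤ dist a b) ∧ 2 * m < δ ∧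
    (∃ w ∈ c, sparsity Xex 3 w = m) ∧
    (∀ x ∈ c, IsLocalMaxPt Xex 3 x → sparsity Xex 3 x = m) ∧
    SetConn Xex 3 (1.01 * m) (c.filter fun x => sparsity Xex 3 x ≤ m)

theorem isSeparated_left : IsSeparated 4 5.98 2 {1, 3, 5, 7.02, 9.02, 11.02} := by
  refine ⟨SetConn.of_hub (z := 1) ?_, by norm_num, ?_, by norm_num, ⟨3, by simp, sparsity_3⟩, ?_,
    SetConn.of_hub (z := 3) ?_⟩
  · have h_3 : EpsConn Xex 3 4 1 3 :=
      .single (by simp [Xex]) (by simp [Xex]) (sparsity_1.le.trans (by norm_num))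
        (sparsity_3.le.trans (by norm_num)) (by norm_num [Real.dist_eq, abs_le])
    have h_5 : EpsConn Xex 3 4 1 5 :=
      h_3.trans <| .single (by simp [Xex]) (by simp [Xex]) (sparsity_3.le.trans (by norm_num))
        (sparsity_5.le.trans (by norm_num)) (by norm_num [Real.dist_eq, abs_le])
    have h_7_02 : EpsConn Xex 3 4 1 7.02 :=
      h_5.trans <| .single (by simp [Xex]) (by simp [Xex]) (sparsity_5.le.trans (by norm_num))
        (sparsity_7_02.le.trans (by norm_num)) (by norm_num [Real.dist_eq, abs_le])
    have h_9_02 : EpsConn Xex 3 4 1 9.02 :=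
      h_7_02.trans <| .single (by simp [Xex]) (by simp [Xex]) (sparsity_7_02.le.trans (by norm_num))
        (sparsity_9_02.le.trans (by norm_num)) (by norm_num [Real.dist_eq, abs_le])
    have h_11_02 : EpsConn Xex 3 4 1 11.02 :=
      h_9_02.trans <| .single (by simp [Xex]) (by simp [Xex]) (sparsity_9_02.le.trans (by norm_num))
        (sparsity_11_02.le.trans (by norm_num)) (by norm_num [Real.dist_eq, abs_le])
    simp only [Finset.forall_mem_insert, Finset.mem_singleton, forall_eq]
    exact ⟨.refl (by simp [Xex]) (sparsity_1.le.trans (by norm_num)), h_3, h_5, h_7_02, h_9_02,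
      h_11_02⟩
  · simp only [Finset.forall_mem_insert, Finset.mem_singleton, forall_eq, forall_mem_Xex]
    norm_num [Real.dist_eq, le_abs]
  · simp only [Finset.forall_mem_insert, Finset.mem_singleton, forall_eq, sparsity_1, sparsity_3,
      sparsity_5, sparsity_7_02, sparsity_9_02, sparsity_11_02]
    refine ⟨fun h => ?_, fun _ => trivial, fun h => ?_, fun h => ?_, fun _ => trivial, fun h => ?_⟩
    · have := h.2 3 (by simp [Xex]) (by rw [sparsity_1]; norm_num [Real.dist_eq, abs_le])
      rw [sparsity_1, sparsity_3] at this
      norm_num at this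
    · have := h.2 3 (by simp [Xex]) (by rw [sparsity_5]; norm_num [Real.dist_eq, abs_le])
      rw [sparsity_5, sparsity_3] at this
      norm_num at this
    · have := h.2 9.02 (by simp [Xex]) (by rw [sparsity_7_02]; norm_num [Real.dist_eq, abs_le])
      rw [sparsity_7_02, sparsity_9_02] at this
      norm_num at this
    · have := h.2 9.02 (by simp [Xex]) (by rw [sparsity_11_02]; norm_num [Real.dist_eq, abs_le])
      rw [sparsity_11_02, sparsity_9_02] at this
      norm_num at this
  · have h_5 : EpsConn Xex 3 (1.01 * 2) 3 5 :=
      .single (by simp [Xex]) (by simp [Xex]) (sparsity_3.le.trans (by norm_num))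
        (sparsity_5.le.trans (by norm_num)) (by norm_num [Real.dist_eq, abs_le])
    have h_7_02 : EpsConn Xex 3 (1.01 * 2) 3 7.02 :=
      h_5.trans <| .single (by simp [Xex]) (by simp [Xex]) (sparsity_5.le.trans (by norm_num))
        (sparsity_7_02.le.trans (by norm_num)) (by norm_num [Real.dist_eq, abs_le])
    have h_9_02 : EpsConn Xex 3 (1.01 * 2) 3 9.02 :=
      h_7_02.trans <| .single (by simp [Xex]) (by simp [Xex]) (sparsity_7_02.le.trans (by norm_num))
        (sparsity_9_02.le.trans (by norm_num)) (by norm_num [Real.dist_eq, abs_le])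
    simp only [Finset.mem_filter, and_imp, Finset.forall_mem_insert, Finset.mem_singleton,
      forall_eq, sparsity_1, sparsity_3, sparsity_5, sparsity_7_02, sparsity_9_02, sparsity_11_02]
    exact ⟨fun h => by norm_num at h,
      fun _ => .refl (by simp [Xex]) (sparsity_3.le.trans (by norm_num)),
      fun h => by norm_num at h, fun h => by norm_num at h, fun _ => h_9_02,
      fun h => by norm_num at h⟩

theorem isSeparated_middle : IsSeparated 2 2.01 1 {17, 18, 19, 20} := by
  refine ⟨SetConn.of_hub (z := 17) ?_, by norm_num, ?_, by norm_num, ⟨18, by simp, sparsity_18⟩,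
    ?_, SetConn.of_hub (z := 18) ?_⟩
  · have h_18 : EpsConn Xex 3 2 17 18 :=
      .single (by simp [Xex]) (by simp [Xex]) (sparsity_17.le.trans (by norm_num))
        (sparsity_18.le.trans (by norm_num)) (by norm_num [Real.dist_eq, abs_le])
    have h_19 : EpsConn Xex 3 2 17 19 :=
      h_18.trans <| .single (by simp [Xex]) (by simp [Xex]) (sparsity_18.le.trans (by norm_num))
        (sparsity_19.le.trans (by norm_num)) (by norm_num [Real.dist_eq, abs_le])
    have h_20 : EpsConn Xex 3 2 17 20 :=
      h_19.trans <| .single (by simp [Xex]) (by simp [Xex]) (sparsity_19.le.trans (by norm_num))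
        (sparsity_20.le.trans (by norm_num)) (by norm_num [Real.dist_eq, abs_le])
    simp only [Finset.forall_mem_insert, Finset.mem_singleton, forall_eq]
    exact ⟨.refl (by simp [Xex]) (sparsity_17.le.trans (by norm_num)), h_18, h_19, h_20⟩
  · simp only [Finset.forall_mem_insert, Finset.mem_singleton, forall_eq, forall_mem_Xex]
    norm_num [Real.dist_eq, le_abs]
  · simp only [Finset.forall_mem_insert, Finset.mem_singleton, forall_eq, sparsity_17, sparsity_18,
      sparsity_19, sparsity_20]
    refine ⟨fun h => ?_, fun _ => trivial, fun _ => trivial, fun h => ?_⟩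
    · have := h.2 18 (by simp [Xex]) (by rw [sparsity_17]; norm_num [Real.dist_eq, abs_le])
      rw [sparsity_17, sparsity_18] at this
      norm_num at this
    · have := h.2 19 (by simp [Xex]) (by rw [sparsity_20]; norm_num [Real.dist_eq, abs_le])
      rw [sparsity_20, sparsity_19] at this
      norm_num at this
  · have h_19 : EpsConn Xex 3 (1.01 * 1) 18 19 :=
      .single (by simp [Xex]) (by simp [Xex]) (sparsity_18.le.trans (by norm_num))
        (sparsity_19.le.trans (by norm_num)) (by norm_num [Real.dist_eq, abs_le])
    simp only [Finset.mem_filter, and_imp, Finset.forall_mem_insert, Finset.mem_singleton,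
      forall_eq, sparsity_17, sparsity_18, sparsity_19, sparsity_20]
    exact ⟨fun h => by norm_num at h,
      fun _ => .refl (by simp [Xex]) (sparsity_18.le.trans (by norm_num)), fun _ => h_19,
      fun h => by norm_num at h⟩

theorem isSeparated_right : IsSeparated 2 2.01 1 {22.01, 23.01, 24.01, 25.01} := by
  refine ⟨SetConn.of_hub (z := 22.01) ?_, by norm_num, ?_, by norm_num, ⟨23.01, by simp,
    sparsity_23_01⟩, ?_, SetConn.of_hub (z := 23.01) ?_⟩
  · have h_23_01 : EpsConn Xex 3 2 22.01 23.01 :=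
      .single (by simp [Xex]) (by simp [Xex]) (sparsity_22_01.le.trans (by norm_num))
        (sparsity_23_01.le.trans (by norm_num)) (by norm_num [Real.dist_eq, abs_le])
    have h_24_01 : EpsConn Xex 3 2 22.01 24.01 :=
      h_23_01.trans <| .single (by simp [Xex]) (by simp [Xex]) (sparsity_23_01.le.trans (by norm_num))
        (sparsity_24_01.le.trans (by norm_num)) (by norm_num [Real.dist_eq, abs_le])
    have h_25_01 : EpsConn Xex 3 2 22.01 25.01 :=
      h_24_01.trans <| .single (by simp [Xex]) (by simp [Xex]) (sparsity_24_01.le.trans (by norm_num))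
        (sparsity_25_01.le.trans (by norm_num)) (by norm_num [Real.dist_eq, abs_le])
    simp only [Finset.forall_mem_insert, Finset.mem_singleton, forall_eq]
    exact ⟨.refl (by simp [Xex]) (sparsity_22_01.le.trans (by norm_num)), h_23_01, h_24_01, h_25_01⟩
  · simp only [Finset.forall_mem_insert, Finset.mem_singleton, forall_eq, forall_mem_Xex]
    norm_num [Real.dist_eq, le_abs]
  · simp only [Finset.forall_mem_insert, Finset.mem_singleton, forall_eq, sparsity_22_01,
      sparsity_23_01, sparsity_24_01, sparsity_25_01]
    refine ⟨fun h => ?_, fun _ => trivial, fun _ => trivial, fun h => ?_⟩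
    · have := h.2 23.01 (by simp [Xex]) (by rw [sparsity_22_01]; norm_num [Real.dist_eq, abs_le])
      rw [sparsity_22_01, sparsity_23_01] at this
      norm_num at this
    · have := h.2 24.01 (by simp [Xex]) (by rw [sparsity_25_01]; norm_num [Real.dist_eq, abs_le])
      rw [sparsity_25_01, sparsity_24_01] at this
      norm_num at this
  · have h_24_01 : EpsConn Xex 3 (1.01 * 1) 23.01 24.01 :=
      .single (by simp [Xex]) (by simp [Xex]) (sparsity_23_01.le.trans (by norm_num))
        (sparsity_24_01.le.trans (by norm_num)) (by norm_num [Real.dist_eq, abs_le])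
    simp only [Finset.mem_filter, and_imp, Finset.forall_mem_insert, Finset.mem_singleton,
      forall_eq, sparsity_22_01, sparsity_23_01, sparsity_24_01, sparsity_25_01]
    exact ⟨fun h => by norm_num at h,
      fun _ => .refl (by simp [Xex]) (sparsity_23_01.le.trans (by norm_num)), fun _ => h_24_01,
      fun h => by norm_num at h⟩

theorem exists_isSeparated : ∀ c ∈ Cex, ∃ e δ m, IsSeparated e δ m c :=
  forall_mem_Cex.2 ⟨⟨_, _, _, isSeparated_left⟩, ⟨_, _, _, isSeparated_middle⟩,
    ⟨_, _, _, isSeparated_right⟩⟩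

theorem nonempty_of_mem_Cex {c : Finset ℝ} (hc : c ∈ Cex) : c.Nonempty := by
  obtain ⟨e, δ, m, -, -, -, -, ⟨w, hw, -⟩, -, -⟩ := exists_isSeparated c hc
  exact ⟨w, hw⟩

theorem le_epsDist_of_mem_Cex {c c' : Finset ℝ} {δ x y : ℝ} (hc : c ∈ Cex) (hc' : c' ∈ Cex)
    (hne : c ≠ c') (gap : ∀ a ∈ c, ∀ b ∈ Xex, b ∈ c ∨ δ ≤ dist a b) (hx : x ∈ c) (hy : y ∈ c') :
    δ ≤ epsDist Xex 3 x y :=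
  le_epsDist (exists_epsConn_Xex (subset_Xex_of_mem_Cex c hc hx) (subset_Xex_of_mem_Cex c' hc' hy))
    hx (Finset.disjoint_right.1 (disjoint_of_mem_Cex c hc c' hc' hne) hy) gap

theorem weaklySeparable_Cex : WeaklySeparable Xex 3 Cex := by
  intro c hc c' hc' hne
  obtain ⟨e, δ, m, hconn, heδ, gap, -, -, -, -⟩ := exists_isSeparated c hc
  have hcn := nonempty_of_mem_Cex hc
  refine (setSparsity_le hcn hconn).trans_lt (heδ.trans_le ?_)
  obtain ⟨x, hx⟩ := hcn
  obtain ⟨y, hy⟩ := nonempty_of_mem_Cex hc'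
  refine le_csInf ⟨_, x, hx, y, hy, rfl⟩ ?_
  rintro _ ⟨a, ha, b, hb, rfl⟩
  exact le_epsDist_of_mem_Cex hc hc' hne.symm gap ha hb

theorem isLocalMaxPt_three : IsLocalMaxPt Xex 3 3 := by
  refine ⟨by simp [Xex], forall_mem_Xex.2 ?_⟩
  simp only [sparsity_1, sparsity_3, sparsity_5, sparsity_7_02, sparsity_9_02, sparsity_11_02,
    sparsity_17, sparsity_18, sparsity_19, sparsity_20, sparsity_22_01, sparsity_23_01,
    sparsity_24_01, sparsity_25_01]
  norm_num [Real.dist_eq, abs_le]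

theorem Aell_Cex_le : Aell Xex 3 Cex ≤ 1.01 := by
  refine csInf_le ⟨relSep Xex 3 3 3, fun A hA => ?_⟩ ?_
  · exact hA 3 isLocalMaxPt_three.1 isLocalMaxPt_three {1, 3, 5, 7.02, 9.02, 11.02} (by simp [Cex])
      (by simp) 3 (by simp) le_rfl
  · intro x hx hmax c hc hxc y hyc hyx
    obtain ⟨e, δ, m, -, -, -, -, -, hlm, hcore⟩ := exists_isSeparated c hc
    have hxm := hlm x hxc hmax
    have hpos : 0 < sparsity Xex 3 x := one_pos.trans_le (one_le_sparsity_Xex x hx)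
    rw [relSep, div_le_iff₀ hpos, hxm]
    exact epsDist_le <| hcore x (Finset.mem_filter.2 ⟨hxc, hxm.le⟩) y
      (Finset.mem_filter.2 ⟨hyc, hyx.trans hxm.le⟩)

theorem lmSeparable_Cex : LMSeparable Xex 3 Cex := by
  intro c hc c' hc' hne z hz
  obtain ⟨e, δ, m, -, -, gap, hmδ, ⟨w, hw, hwm⟩, -, -⟩ := exists_isSeparated c hc
  obtain ⟨hzc, hzmin⟩ := Finset.mem_filter.1 hz
  have hzm : sparsity Xex 3 z ≤ m := hwm ▸ hzmin w hw
  have hpos : 0 < sparsity Xex 3 z :=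
    one_pos.trans_le (one_le_sparsity_Xex z (subset_Xex_of_mem_Cex c hc hzc))
  refine Aell_Cex_le.trans_lt (lt_of_lt_of_le (b := 2) (by norm_num) ?_)
  obtain ⟨y, hy⟩ := nonempty_of_mem_Cex hc'
  refine le_csInf ⟨_, y, hy, rfl⟩ ?_
  rintro _ ⟨b, hb, rfl⟩
  have := le_epsDist_of_mem_Cex hc hc' hne gap hzc hb
  rw [relSep, le_div_iff₀ hpos]
  linarith

/-- Cex is weakly separable and LM-separable for N_p = 3, yet for every
ε ≥ 0, Cex does not extend the partial clustering consisting of all ε-clusters of Xex: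
there is no bijection f from the set of ε-clusters onto Cex with each ε-cluster contained
in its image. -/
theorem stmt_17 :
    WeaklySeparable Xex 3 Cex ∧ LMSeparable Xex 3 Cex ∧
    ∀ ε : ℝ, 0 ≤ ε →
      ¬ ∃ f : Finset ℝ → Finset ℝ,
          Set.BijOn f {c : Finset ℝ | IsEpsCluster Xex 3 ε c} (↑Cex : Set (Finset ℝ)) ∧
          ∀ c : Finset ℝ, IsEpsCluster Xex 3 ε c → c ⊆ f c := by
  refine ⟨weaklySeparable_Cex, lmSeparable_Cex, ?_⟩
  rintro ε - ⟨f, ⟨hmaps, hinj, hsurj⟩, hsub⟩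
  obtain ⟨c, hc, hfc⟩ := hsurj (show {1, 3, 5, 7.02, 9.02, 11.02} ∈ (Cex : Set (Finset ℝ)) by
    simp [Cex])
  have two_le : 2 ≤ ε := by
    obtain ⟨x, hx⟩ := hc.1
    have hx' := hsub c hc hx
    rw [hfc] at hx'
    have hle : ∀ x ∈ ({1, 3, 5, 7.02, 9.02, 11.02} : Finset ℝ), 2 ≤ sparsity Xex 3 x := by
      simp only [Finset.forall_mem_insert, Finset.mem_singleton, forall_eq, sparsity_1, sparsity_3,
        sparsity_5, sparsity_7_02, sparsity_9_02, sparsity_11_02]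
      norm_num
    exact (hle x hx').trans (hc.2.1 x hx x hx).2.1
  have lt_gap : ε < 2.01 := by
    by_contra! hε
    have h20 : sparsity Xex 3 20 ≤ ε := by rw [sparsity_20]; exact two_le
    obtain ⟨b, hb, hmem⟩ := exists_isEpsCluster (by simp [Xex]) h20
    have h1 := hsub b hb ((hmem 20).2 (.refl (by simp [Xex]) h20))
    have h2 := hsub b hb ((hmem 22.01).2 (.single (by simp [Xex]) (by simp [Xex]) h20
      (by rw [sparsity_22_01]; exact two_le)
      (le_trans (by norm_num [Real.dist_eq, abs_le]) hε)))
    have key : ∀ c ∈ Cex, (20 : ℝ) ∈ c → (22.01 : ℝ) ∉ c := by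
      rw [forall_mem_Cex]
      norm_num
    exact key _ (hmaps hb) h1 h2
  have h3 : sparsity Xex 3 3 ≤ ε := by rw [sparsity_3]; exact two_le
  have h9 : sparsity Xex 3 9.02 ≤ ε := by rw [sparsity_9_02]; exact two_le
  obtain ⟨a, ha, hamem⟩ := exists_isEpsCluster (by simp [Xex]) h3
  obtain ⟨b, hb, hbmem⟩ := exists_isEpsCluster (by simp [Xex]) h9
  have key : ∀ c ∈ Cex, ∀ c' ∈ Cex, (3 : ℝ) ∈ c → (9.02 : ℝ) ∈ c' → c = c' := by
    simp only [forall_mem_Cex]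
    norm_num
  have hab : a = b := hinj ha hb <| key _ (hmaps ha) _ (hmaps hb)
    (hsub a ha ((hamem 3).2 (.refl (by simp [Xex]) h3)))
    (hsub b hb ((hbmem 9.02).2 (.refl (by simp [Xex]) h9)))
  have hconn : EpsConn Xex 3 ε 3 9.02 :=
    (hamem _).1 (hab ▸ (hbmem 9.02).2 (.refl (by simp [Xex]) h9))
  have h93 : (9.02 : ℝ) ∈ ({3} : Set ℝ) := by
    refine hconn.mem_of_closed rfl ?_
    rintro _ rfl b hb hsb hdb
    have step : ∀ b ∈ Xex, b = 3 ∨ 2.01 ≤ sparsity Xex 3 b ∨ 2.01 ≤ dist 3 b := by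
      rw [forall_mem_Xex, sparsity_1, sparsity_3, sparsity_5, sparsity_7_02, sparsity_9_02,
        sparsity_11_02, sparsity_17, sparsity_18, sparsity_19, sparsity_20, sparsity_22_01,
        sparsity_23_01, sparsity_24_01, sparsity_25_01]
      norm_num [Real.dist_eq, le_abs]
    rcases step b hb with h | h | h
    · exact h
    · linarith
    · linarith
  norm_num at h93
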